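/- arXiv:2310.15584 — 5 statements merged into one kernel-verified Lean document; each statement's English description precedes it below -/
import Mathlib

section
/- Let K ≥ 1 and for each k ∈ Fin K let c_k ∈ ℝ and d_k > 0. Suppose τ* ∈ ℝ satisfies τ* > c_k for all k and ∑_{k} d_k/(τ* − c_k) = 1. Define b*_k = d_k/(τ* − c_k). Then: (i) b*_k > 0 for all k; (ii) ∑_k b*_k = 1; (iii) c_k + d_k/b*_k = τ* for every k; and (iv) for every b : Fin K → ℝ with b_k > 0 for all k and ∑_k b_k ≤ 1, one has max over k of (c_k + d_k/b_k) ≥ τ*. In other words, the allocation b* equalizes all device latencies at τ* and minimizes the maximum latency over all feasible bandwidth allocations. -/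
/-- Theorem 2 of the paper: the allocation `b*_k = d_k/(τ* − c_k)` equalizes all
device latencies at `τ*` and minimizes the maximum latency over all feasible
bandwidth allocations. -/
theorem stmt_0 (K : ℕ) (hK : 1 ≤ K) (c d : Fin K → ℝ) (hd : ∀ k, 0 < d k)
    (τstar : ℝ) (hτ : ∀ k, c k < τstar)
    (hsum : ∑ k, d k / (τstar - c k) = 1)
    (bstar : Fin K → ℝ) (hbstar : ∀ k, bstar k = d k / (τstar - c k)) :
    (∀ k, 0 < bstar k) ∧
    (∑ k, bstar k = 1) ∧
    (∀ k, c k + d k / bstar k = τstar) ∧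
    (∀ b : Fin K → ℝ, (∀ k, 0 < b k) → (∑ k, b k ≤ 1) →
      τstar ≤ Finset.univ.sup' (Finset.univ_nonempty_iff.mpr ⟨⟨0, hK⟩⟩)
        (fun k => c k + d k / b k)) := by
  have hpos : ∀ k, 0 < τstar - c k := fun k => sub_pos.mpr (hτ k)
  refine ⟨fun k => ?_, ?_, fun k => ?_, fun b hb hb1 => ?_⟩
  · rw [hbstar]
    exact div_pos (hd k) (hpos k)
  · simpa only [hbstar] using hsum
  · rw [hbstar, div_div_cancel₀ (hd k).ne', add_sub_cancel]
  · by_contra! h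
    rw [Finset.sup'_lt_iff] at h
    have hlt : ∀ k, d k / (τstar - c k) < b k := fun k => by
      rw [div_lt_comm₀ (hpos k) (hb k)]
      linarith [h k (Finset.mem_univ k)]
    have hsum_lt : ∑ k, d k / (τstar - c k) < ∑ k, b k :=
      Finset.sum_lt_sum_of_nonempty (Finset.univ_nonempty_iff.mpr ⟨⟨0, hK⟩⟩)
        fun k _ => hlt k
    linarith
end

section
/- Let K ≥ 2 and for each k ∈ Fin K let c_k ∈ ℝ and d_k > 0. Let b : Fin K → ℝ satisfy b_k > 0 for all k and ∑_k b_k = 1, and suppose the values c_k + d_k/b_k, k ∈ Fin K, are not all equal. Then there exists b' : Fin K → ℝ with b'_k > 0 for all k and ∑_k b'_k ≤ 1 such that max over k of (c_k + d_k/b'_k) < max over k of (c_k + d_k/b_k). Hence an allocation can be optimal only if all device latencies are equal. -/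
/-- The paper's contradiction argument: if a feasible allocation using the whole
bandwidth does not equalize all device latencies, then it is not optimal, i.e.,
there is a feasible allocation with strictly smaller maximum latency. -/
theorem stmt_1 (K : ℕ) (hK : 2 ≤ K) (c d : Fin K → ℝ) (hd : ∀ k, 0 < d k)
    (b : Fin K → ℝ) (hb : ∀ k, 0 < b k) (hbsum : ∑ k, b k = 1)
    (hne : ¬ ∀ j k : Fin K, c j + d j / b j = c k + d k / b k) :
    ∃ b' : Fin K → ℝ, (∀ k, 0 < b' k) ∧ (∑ k, b' k ≤ 1) ∧
      Finset.univ.sup' (Finset.univ_nonempty_iff.mpr ⟨⟨0, by omega⟩⟩)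
          (fun k => c k + d k / b' k) <
        Finset.univ.sup' (Finset.univ_nonempty_iff.mpr ⟨⟨0, by omega⟩⟩)
          (fun k => c k + d k / b k) := by
  set M := Finset.univ.sup' (Finset.univ_nonempty_iff.mpr ⟨⟨0, by omega⟩⟩)
    (fun k => c k + d k / b k)
  have le_M (k : Fin K) : c k + d k / b k ≤ M :=
    Finset.le_sup' (fun k => c k + d k / b k) (Finset.mem_univ k)
  obtain ⟨j, hj⟩ : ∃ j, c j + d j / b j < M := by
    by_contra! h
    exact hne fun j k => ((le_M j).antisymm (h j)).trans ((le_M k).antisymm (h k)).symm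
  have hcont : ContinuousAt (fun ε : ℝ => b j + ε - K * ε) 0 := by fun_prop
  have hlat : ContinuousAt (fun ε : ℝ => c j + d j / (b j + ε - K * ε)) 0 :=
    continuousAt_const.add (continuousAt_const.div hcont (by simpa using (hb j).ne'))
  have hpos : ∀ᶠ ε in nhds (0 : ℝ), 0 < b j + ε - K * ε :=
    hcont.eventually (lt_mem_nhds (by simpa using hb j))
  have hlt : ∀ᶠ ε in nhds (0 : ℝ), c j + d j / (b j + ε - K * ε) < M :=
    hlat.eventually (gt_mem_nhds (by simpa using hj))
  obtain ⟨ε, ⟨hε_pos, hε_lt⟩, hε_mem⟩ :=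
    (((hpos.and hlt).filter_mono nhdsWithin_le_nhds).and
      (self_mem_nhdsWithin (s := Set.Ioi (0 : ℝ)))).exists
  have hε : 0 < ε := hε_mem
  refine ⟨fun k => b k + ε - if k = j then K * ε else 0, fun k => ?_, ?_, ?_⟩
  · by_cases hk : k = j
    · subst hk
      simpa using hε_pos
    · simpa [hk] using add_pos (hb k) hε
  · simp [Finset.sum_sub_distrib, Finset.sum_add_distrib, hbsum]
  · refine (Finset.sup'_lt_iff _).mpr fun k _ => ?_
    by_cases hk : k = j
    · subst hk
      simpa using hε_lt
    · simp only [hk, if_false, sub_zero]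
      have h : d k / (b k + ε) < d k / b k :=
        div_lt_div_of_pos_left (hd k) (hb k) (lt_add_of_pos_right _ hε)
      linarith [le_M k]
end

section
/- Let K ≥ 1 and for each k ∈ Fin K let c_k ∈ ℝ and d_k > 0, and set c_max = max over k of c_k. Then there exists a unique τ* ∈ (c_max, ∞) such that ∑_k d_k/(τ* − c_k) = 1. -/
theorem strictAntiOn_sum_div_sub {ι : Type*} [Fintype ι] [Nonempty ι] {c d : ι → ℝ} {M : ℝ}
    (hc : ∀ k, c k ≤ M) (hd : ∀ k, 0 < d k) :
    StrictAntiOn (fun t : ℝ => ∑ k, d k / (t - c k)) (Set.Ioi M) := fun s hs t _ hst =>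
  Finset.sum_lt_sum_of_nonempty Finset.univ_nonempty fun k _ =>
    div_lt_div_of_pos_left (hd k) (sub_pos.mpr ((hc k).trans_lt hs)) (by linarith)

theorem continuousOn_sum_div_sub {ι : Type*} [Fintype ι] {c d : ι → ℝ} {M : ℝ}
    (hc : ∀ k, c k ≤ M) :
    ContinuousOn (fun t : ℝ => ∑ k, d k / (t - c k)) (Set.Ioi M) :=
  continuousOn_finsetSum _ fun k _ =>
    continuousOn_const.div (continuousOn_id.sub continuousOn_const) fun _ ht =>
      (sub_pos.mpr ((hc k).trans_lt ht)).ne'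

/-- If `M = c m` is the maximum of `c`, the sum is at least `1` at `M + d m` and at most `1`
at `M + ∑ k, d k`, so it takes the value `1` in between. -/
theorem exists_sum_div_sub_eq_one {ι : Type*} [Fintype ι] {c d : ι → ℝ} {m : ι}
    (hc : ∀ k, c k ≤ c m) (hd : ∀ k, 0 < d k) :
    ∃ t ∈ Set.Ioi (c m), ∑ k, d k / (t - c k) = 1 := by
  have hle : d m ≤ ∑ k, d k :=
    Finset.single_le_sum (fun k _ => (hd k).le) (Finset.mem_univ m)
  have hpos : 0 < ∑ k, d k := (hd m).trans_le hle
  have hsub : Set.Icc (c m + d m) (c m + ∑ k, d k) ⊆ Set.Ioi (c m) := fun t ht =>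
    (lt_add_of_pos_right _ (hd m)).trans_le ht.1
  have hlower : 1 ≤ ∑ k, d k / (c m + d m - c k) := by
    calc (1 : ℝ) = d m / (c m + d m - c m) := by
          rw [add_sub_cancel_left, div_self (hd m).ne']
      _ ≤ _ := Finset.single_le_sum (f := fun k => d k / (c m + d m - c k))
          (fun k _ => div_nonneg (hd k).le (by linarith [hc k, hd m])) (Finset.mem_univ m)
  have hupper : ∑ k, d k / (c m + ∑ j, d j - c k) ≤ 1 := by
    calc _ ≤ ∑ k, d k / ∑ j, d j := Finset.sum_le_sum fun k _ =>
          div_le_div_of_nonneg_left (hd k).le hpos (by linarith [hc k])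
      _ = 1 := by rw [← Finset.sum_div, div_self hpos.ne']
  obtain ⟨t, ht, heq⟩ := intermediate_value_Icc' (by linarith)
    ((continuousOn_sum_div_sub hc).mono hsub) ⟨hupper, hlower⟩
  exact ⟨t, hsub ht, heq⟩

/-- Existence and uniqueness of the equalizing latency `τ*` with
`∑_k d_k/(τ* − c_k) = 1` on `(c_max, ∞)`, underlying the binary search of
Algorithm 1. -/
theorem stmt_2 (K : ℕ) (hK : 1 ≤ K) (c d : Fin K → ℝ) (hd : ∀ k, 0 < d k) :
    ∃! τstar : ℝ,
      τstar ∈ Set.Ioi (Finset.univ.sup' (Finset.univ_nonempty_iff.mpr ⟨⟨0, hK⟩⟩) c) ∧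
      ∑ k, d k / (τstar - c k) = 1 := by
  have : Nonempty (Fin K) := ⟨⟨0, hK⟩⟩
  obtain ⟨m, -, hm⟩ := Finset.exists_mem_eq_sup' Finset.univ_nonempty c
  have hc : ∀ k, c k ≤ c m := fun k => hm ▸ Finset.le_sup' c (Finset.mem_univ k)
  rw [hm]
  obtain ⟨t, ht, heq⟩ := exists_sum_div_sub_eq_one hc hd
  exact ⟨t, ⟨ht, heq⟩, fun s hs =>
    (strictAntiOn_sum_div_sub hc hd).injOn hs.1 ht (hs.2.trans heq.symm)⟩
end

section
/- Let ε > 0, c > 0, a > 0, m ∈ ℝ, and let V ∈ ℝ satisfy V ≥ a·c + m. Set T = V − m (so T ≥ a·c). Then ∫_{a·c}^{∞} min(θ + m, V) · (ε/c) · exp(−(ε/c)(θ − a·c)) dθ = a·c + c/ε − (T + c/ε)·exp(−(ε/c)(T − a·c)) + (1 − exp(−(ε/c)(T − a·c)))·m + V·exp(−(ε/c)(T − a·c)). -/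
open MeasureTheory Real

lemma hasDerivAt_exp_neg_mul_sub (k b x : ℝ) :
    HasDerivAt (fun θ => exp (-k * (θ - b))) (-(k * exp (-k * (x - b)))) x := by
  convert (((hasDerivAt_id' x).sub_const b).const_mul (-k)).exp using 1
  ring

lemma tendsto_neg_exp_neg_mul_sub {k : ℝ} (hk : 0 < k) (b : ℝ) :
    Filter.Tendsto (fun θ => -exp (-k * (θ - b))) Filter.atTop (nhds 0) := by
  rw [← neg_zero]
  refine (tendsto_exp_atBot.comp ?_).neg
  exact (Filter.tendsto_atTop_add_const_right _ (-b) Filter.tendsto_id).const_mul_atTop_of_neg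
    (neg_lt_zero.2 hk)

lemma integrableOn_shiftedExp_Ioi {k : ℝ} (hk : 0 < k) (b t : ℝ) :
    IntegrableOn (fun θ => k * exp (-k * (θ - b))) (Set.Ioi t) :=
  integrableOn_Ioi_deriv_of_nonneg'
    (fun x _ => by simpa using (hasDerivAt_exp_neg_mul_sub k b x).fun_neg)
    (fun _ _ => by positivity) (tendsto_neg_exp_neg_mul_sub hk b)

lemma integral_shiftedExp_Ioi {k : ℝ} (hk : 0 < k) (b t : ℝ) :
    ∫ θ in Set.Ioi t, k * exp (-k * (θ - b)) = exp (-k * (t - b)) := by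
  rw [integral_Ioi_of_hasDerivAt_of_tendsto'
    (fun x _ => by simpa using (hasDerivAt_exp_neg_mul_sub k b x).fun_neg)
    (integrableOn_shiftedExp_Ioi hk b t) (tendsto_neg_exp_neg_mul_sub hk b)]
  ring

lemma integral_add_mul_shiftedExp {k : ℝ} (hk : k ≠ 0) (b m s t : ℝ) :
    ∫ θ in s..t, (θ + m) * (k * exp (-k * (θ - b)))
      = (s + m + k⁻¹) * exp (-k * (s - b)) - (t + m + k⁻¹) * exp (-k * (t - b)) := by
  rw [intervalIntegral.integral_eq_sub_of_hasDerivAt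
    (f := fun θ => -((θ + m + k⁻¹) * exp (-k * (θ - b))))]
  · ring
  · intro x _
    convert ((((hasDerivAt_id' x).add_const m).add_const k⁻¹).fun_mul
      (hasDerivAt_exp_neg_mul_sub k b x)).fun_neg using 1
    field_simp
    ring
  · exact Continuous.intervalIntegrable (by fun_prop) _ _

/-- The mean of a shifted exponential variable, translated by `m` and truncated at `t + m`. -/
lemma integral_min_mul_shiftedExp {k b t : ℝ} (hk : 0 < k) (hbt : b ≤ t) (m : ℝ) :
    ∫ θ in Set.Ioi b, min (θ + m) (t + m) * (k * exp (-k * (θ - b)))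
      = b + m + k⁻¹ - k⁻¹ * exp (-k * (t - b)) := by
  have left : Set.EqOn (fun θ => min (θ + m) (t + m) * (k * exp (-k * (θ - b))))
      (fun θ => (θ + m) * (k * exp (-k * (θ - b)))) (Set.Ioc b t) := fun θ hθ => by
    simp only [min_eq_left (add_le_add_left hθ.2 m)]
  have right : Set.EqOn (fun θ => min (θ + m) (t + m) * (k * exp (-k * (θ - b))))
      (fun θ => (t + m) * (k * exp (-k * (θ - b)))) (Set.Ioi t) := fun θ hθ => by
    simp only [min_eq_right (add_le_add_left (Set.mem_Ioi.1 hθ).le m)]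
  rw [← Set.Ioc_union_Ioi_eq_Ioi hbt,
    setIntegral_union (Set.Ioc_disjoint_Ioi le_rfl) measurableSet_Ioi
      (Continuous.integrableOn_Ioc (by fun_prop))
      (IntegrableOn.congr_fun ((integrableOn_shiftedExp_Ioi hk b t).const_mul (t + m))
        right.symm measurableSet_Ioi),
    setIntegral_congr_fun measurableSet_Ioc left, setIntegral_congr_fun measurableSet_Ioi right,
    ← intervalIntegral.integral_of_le hbt, integral_add_mul_shiftedExp hk.ne',
    integral_const_mul, integral_shiftedExp_Ioi hk, sub_self, mul_zero, exp_zero]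
  ring

/-- Closed form for the expected value `E[min(τ^cp + τ^cm, E(V_{ℓ+1}))]` in the
backward induction of the split-point optimization (equation (16) of the paper). -/
theorem stmt_5 (ε c a m V : ℝ) (hε : 0 < ε) (hc : 0 < c) (ha : 0 < a)
    (hV : a * c + m ≤ V) (T : ℝ) (hT : T = V - m) :
    ∫ θ in Set.Ioi (a * c),
        min (θ + m) V * ((ε / c) * Real.exp (-(ε / c) * (θ - a * c)))
      = a * c + c / ε - (T + c / ε) * Real.exp (-(ε / c) * (T - a * c))
        + (1 - Real.exp (-(ε / c) * (T - a * c))) * m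
        + V * Real.exp (-(ε / c) * (T - a * c)) := by
  obtain rfl : V = T + m := by linarith
  rw [integral_min_mul_shiftedExp (div_pos hε hc) (by linarith) m, inv_div]
  ring
end

section
/- Let E be a real inner product space, let F : E → ℝ be differentiable with gradient ∇F, let β > 0, and suppose: (i) F is convex, i.e., F(v) ≥ F(w) + ⟪v − w, ∇F(w)⟫ for all v, w ∈ E; (ii) F is β-smooth, i.e., F(v) ≤ F(w) + ⟪v − w, ∇F(w)⟫ + (β/2)·‖v − w‖² for all v, w ∈ E; (iii) F* ∈ ℝ satisfies F(v) ≥ F* for all v ∈ E. Then for every w, w̄ ∈ E and every η > 0, F(w) − F* ≥ (1 − η·β)·(F(w̄) − F*) − (1/(2η))·‖w − w̄‖². -/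
open RealInnerProductSpace

/-- The gradient of a smooth function is controlled by its suboptimality gap. -/
lemma norm_sq_gradient_le_of_smooth {E : Type*} [NormedAddCommGroup E] [InnerProductSpace ℝ E]
    {F : E → ℝ} {β m : ℝ} (hβ : 0 < β) {w g : E}
    (hsmooth : ∀ v, F v ≤ F w + ⟪v - w, g⟫ + β / 2 * ‖v - w‖ ^ 2)
    (hm : ∀ v, m ≤ F v) : ‖g‖ ^ 2 ≤ 2 * β * (F w - m) := by
  have h := (hm _).trans (hsmooth (w - β⁻¹ • g))
  rw [sub_sub_cancel_left, inner_neg_left, real_inner_smul_left, real_inner_self_eq_norm_sq,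
    norm_neg, norm_smul, Real.norm_of_nonneg (inv_nonneg.2 hβ.le)] at h
  have hstep : β / 2 * (β⁻¹ * ‖g‖) ^ 2 = ‖g‖ ^ 2 / (2 * β) := by field_simp
  have hinner : β⁻¹ * ‖g‖ ^ 2 = 2 * (‖g‖ ^ 2 / (2 * β)) := by field_simp
  have hdiv : ‖g‖ ^ 2 / (2 * β) ≤ F w - m := by linarith
  rwa [div_le_iff₀' (by positivity)] at hdiv

/-- Weighted Young inequality for the real inner product. -/
lemma neg_inner_le_weighted_norm_sq {E : Type*} [NormedAddCommGroup E] [InnerProductSpace ℝ E]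
    (a b : E) {η : ℝ} (hη : 0 < η) :
    -⟪a, b⟫ ≤ η / 2 * ‖b‖ ^ 2 + 1 / (2 * η) * ‖a‖ ^ 2 := by
  have h := norm_add_sq_real a (η • b)
  rw [real_inner_smul_right, norm_smul, Real.norm_of_nonneg hη.le] at h
  have hexpand : η / 2 * ‖b‖ ^ 2 + 1 / (2 * η) * ‖a‖ ^ 2 + ⟪a, b⟫
      = 1 / (2 * η) * ‖a + η • b‖ ^ 2 := by
    rw [h]
    field_simp
    ring
  have hnonneg : 0 ≤ 1 / (2 * η) * ‖a + η • b‖ ^ 2 := by positivity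
  linarith

/-- Chain of inequalities (35) in the appendix: for a convex β-smooth function
bounded below by `F*`, for all `w, w̄` and `η > 0`,
`F(w) − F* ≥ (1 − ηβ)(F(w̄) − F*) − (1/(2η))‖w − w̄‖²`. -/
theorem stmt_11 {E : Type*} [NormedAddCommGroup E] [InnerProductSpace ℝ E]
    [CompleteSpace E] (F : E → ℝ) (gradF : E → E)
    (hdiff : ∀ w, HasGradientAt F (gradF w) w)
    (β : ℝ) (hβ : 0 < β)
    (hconv : ∀ v w : E, F w + ⟪v - w, gradF w⟫ ≤ F v)
    (hsmooth : ∀ v w : E,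
      F v ≤ F w + ⟪v - w, gradF w⟫ + β / 2 * ‖v - w‖ ^ 2)
    (Fstar : ℝ) (hFstar : ∀ v : E, Fstar ≤ F v) :
    ∀ (w wbar : E) (η : ℝ), 0 < η →
      (1 - η * β) * (F wbar - Fstar) - 1 / (2 * η) * ‖w - wbar‖ ^ 2
        ≤ F w - Fstar := by
  intro w wbar η hη
  have hgrad := norm_sq_gradient_le_of_smooth hβ (fun v => hsmooth v wbar) hFstar
  have hyoung := neg_inner_le_weighted_norm_sq (w - wbar) (gradF wbar) hη
  have hscaled := mul_le_mul_of_nonneg_left hgrad (half_pos hη).le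
  linarith [hconv w wbar]
end
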